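/- Let f ⊆ {0,1}^n × R be a relation. Then for every positive integer m: PDT(f ∘ IND_m) ≥ DT(f)·m, sDT(f ∘ IND_m) ≥ DT(f)·m, and PDTsize(f ∘ IND_m) ≥ 2^{DT(f)·m}. -/

import Mathlib

/-- A Boolean function `g` on coordinates `ι` is `k`-stifled if for every set `S` of at most
`k` coordinates and every target bit `b`, there is an assignment to the coordinates outside `S`
that forces the value of `g` to be `b`. -/
def Stifled {ι : Type} (g : (ι → ZMod 2) → ZMod 2) (k : ℕ) : Prop :=
  ∀ S : Finset ι, S.card ≤ k → ∀ b : ZMod 2,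
    ∃ z : ι → ZMod 2, ∀ x : ι → ZMod 2, (∀ i, i ∉ S → x i = z i) → g x = b

/-- The composed relation `f ∘ g` on inputs split into `n` blocks of coordinates `κ`. -/
def Compose {n : ℕ} {κ R : Type} (f : (Fin n → ZMod 2) → R → Prop)
    (g : (κ → ZMod 2) → ZMod 2) : ((Fin n × κ) → ZMod 2) → R → Prop :=
  fun y r => f (fun i => g fun j => y (i, j)) r

/-- Deterministic decision trees querying single coordinates. -/
inductive DTree (ι R : Type) : Type where
  | leaf (r : R) : DTree ι R
  | node (i : ι) (t0 t1 : DTree ι R) : DTree ι R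

namespace DTree

variable {ι R : Type}

def depth : DTree ι R → ℕ
  | leaf _ => 0
  | node _ t0 t1 => max (depth t0) (depth t1) + 1

def eval : DTree ι R → (ι → ZMod 2) → R
  | leaf r, _ => r
  | node i t0 t1, x => if x i = 1 then eval t1 x else eval t0 x

def Computes (T : DTree ι R) (f : (ι → ZMod 2) → R → Prop) : Prop :=
  ∀ x, f x (T.eval x)

end DTree

/-- Deterministic decision tree complexity: the minimum depth of a decision tree computing `f`. -/
noncomputable def DTdepth {ι R : Type} (f : (ι → ZMod 2) → R → Prop) : ℕ :=
  sInf {d | ∃ T : DTree ι R, T.Computes f ∧ T.depth = d}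

/-- Parity decision trees: each node queries a parity `⟨P, x⟩` over `F₂`. -/
inductive PDTree (ι R : Type) : Type where
  | leaf (r : R) : PDTree ι R
  | node (P : ι → ZMod 2) (t0 t1 : PDTree ι R) : PDTree ι R

namespace PDTree

variable {ι R : Type} [Fintype ι]

def depth {ι R : Type} : PDTree ι R → ℕ
  | leaf _ => 0
  | node _ t0 t1 => max (depth t0) (depth t1) + 1

/-- The number of leaves of a parity decision tree. -/
def size {ι R : Type} : PDTree ι R → ℕ
  | leaf _ => 1
  | node _ t0 t1 => size t0 + size t1

def eval : PDTree ι R → (ι → ZMod 2) → R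
  | leaf r, _ => r
  | node P t0 t1, x => if (∑ i, P i * x i) = 1 then eval t1 x else eval t0 x

def Computes (T : PDTree ι R) (f : (ι → ZMod 2) → R → Prop) : Prop :=
  ∀ x, f x (T.eval x)

end PDTree

/-- Parity decision tree depth complexity. -/
noncomputable def PDTdepth {ι R : Type} [Fintype ι] (f : (ι → ZMod 2) → R → Prop) : ℕ :=
  sInf {d | ∃ T : PDTree ι R, T.Computes f ∧ T.depth = d}

/-- Parity decision tree size complexity: the minimum number of leaves of a PDT computing `f`. -/
noncomputable def PDTsizeMin {ι R : Type} [Fintype ι] (f : (ι → ZMod 2) → R → Prop) : ℕ :=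
  sInf {s | ∃ T : PDTree ι R, T.Computes f ∧ T.size = s}

/-- Subspace decision trees: each node queries membership in an affine subspace of `F₂^ι`. -/
inductive SDTree (ι R : Type) : Type where
  | leaf (r : R) : SDTree ι R
  | node (A : AffineSubspace (ZMod 2) (ι → ZMod 2)) (t0 t1 : SDTree ι R) : SDTree ι R

namespace SDTree

variable {ι R : Type}

def depth : SDTree ι R → ℕ
  | leaf _ => 0
  | node _ t0 t1 => max (depth t0) (depth t1) + 1

open Classical in
noncomputable def eval : SDTree ι R → (ι → ZMod 2) → R
  | leaf r, _ => r
  | node A t0 t1, x => if x ∈ A then eval t1 x else eval t0 x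

def Computes (T : SDTree ι R) (f : (ι → ZMod 2) → R → Prop) : Prop :=
  ∀ x, f x (T.eval x)

end SDTree

/-- Subspace decision tree depth complexity. -/
noncomputable def SDTdepth {ι R : Type} (f : (ι → ZMod 2) → R → Prop) : ℕ :=
  sInf {d | ∃ T : SDTree ι R, T.Computes f ∧ T.depth = d}

/-- A non-adaptive decision tree with `q` queries `qs` (fixed in advance) computes `f`
if the output, a function of the answers only, is always a valid value for `f`. -/
def NADTComputes {ι R : Type} (q : ℕ) (qs : Fin q → ι)
    (out : (Fin q → ZMod 2) → R) (f : (ι → ZMod 2) → R → Prop) : Prop :=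
  ∀ x, f x (out fun t => x (qs t))

/-- Non-adaptive decision tree complexity: the minimum number of (fixed) queries. -/
noncomputable def NADT {ι R : Type} (f : (ι → ZMod 2) → R → Prop) : ℕ :=
  sInf {q | ∃ qs : Fin q → ι, ∃ out : (Fin q → ZMod 2) → R, NADTComputes q qs out f}

/-- A non-adaptive parity decision tree with `q` parity queries `qs` (fixed in advance)
computes `f` if the output, a function of the parity answers only, is always valid for `f`. -/
def NAPDTComputes {ι R : Type} [Fintype ι] (q : ℕ) (qs : Fin q → ι → ZMod 2)
    (out : (Fin q → ZMod 2) → R) (f : (ι → ZMod 2) → R → Prop) : Prop :=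
  ∀ x, f x (out fun t => ∑ i, qs t i * x i)

/-- The number `bin x ∈ [2^m]` represented by the binary expansion `x`. -/
def binIndex {m : ℕ} (x : Fin m → ZMod 2) : Fin (2 ^ m) :=
  finFunctionFinEquiv fun i => (⟨(x i).val, ZMod.val_lt (x i)⟩ : Fin 2)

/-- The Indexing function: `m` addressing variables select one of `2^m` target variables. -/
def IND (m : ℕ) : ((Fin m ⊕ Fin (2 ^ m)) → ZMod 2) → ZMod 2 :=
  fun w => w (Sum.inr (binIndex fun i => w (Sum.inl i)))

/-- The Inner Product Modulo 2 function on `2m` bits. -/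
def IP (m : ℕ) : ((Fin m ⊕ Fin m) → ZMod 2) → ZMod 2 :=
  fun w => ∑ i : Fin m, w (Sum.inl i) * w (Sum.inr i)

/-- The Majority function: `1` iff at least `n/2` of the `n` input bits are `1`. -/
def MAJ (n : ℕ) : (Fin n → ZMod 2) → ZMod 2 :=
  fun x => if n ≤ 2 * (Finset.univ.filter fun i => x i = 1).card then 1 else 0

/-- A nonempty-agnostic notion of affine set over `F₂`. -/
def AffSet {E : Type} [AddCommGroup E] (A : Set E) : Prop :=
  ∀ x ∈ A, ∀ y ∈ A, ∀ z ∈ A, x - y + z ∈ A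

/-- `Cheap h c A`: an adversary can force a valid answer by imposing at most `c` linear equations,
where the set may be shrunk arbitrarily between the rounds. -/
def Cheap {ι R : Type} (h : (ι → ZMod 2) → R → Prop) : ℕ → Set (ι → ZMod 2) → Prop
  | 0, A => ∃ r, ∀ y ∈ A, h y r
  | c + 1, A => (∃ r, ∀ y ∈ A, h y r) ∨
      ∃ (l : (ι → ZMod 2) →ₗ[ZMod 2] ZMod 2) (b : ZMod 2), (∃ y ∈ A, l y = b) ∧
        ∀ A' : Set (ι → ZMod 2), A'.Nonempty → (∀ y ∈ A', y ∈ A ∧ l y = b) → Cheap h c A'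

lemma Cheap.of_label {ι R : Type} {h : (ι → ZMod 2) → R → Prop} {c : ℕ}
    {A : Set (ι → ZMod 2)} (H : ∃ r, ∀ y ∈ A, h y r) : Cheap h c A := by
  cases c with
  | zero => exact H
  | succ c => exact Or.inl H

lemma Cheap.succ {ι R : Type} {h : (ι → ZMod 2) → R → Prop} {c : ℕ} :
    ∀ {A : Set (ι → ZMod 2)}, Cheap h c A → Cheap h (c + 1) A := by
  induction c with
  | zero => intro A H; exact Or.inl H
  | succ c ih =>
    intro A H
    rcases H with H | ⟨l, b, hy, H⟩
    · exact Or.inl H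
    · exact Or.inr ⟨l, b, hy, fun A' h1 h2 => ih (H A' h1 h2)⟩

lemma Cheap.mono {ι R : Type} {h : (ι → ZMod 2) → R → Prop} {c d : ℕ} (hcd : c ≤ d)
    {A : Set (ι → ZMod 2)} (H : Cheap h c A) : Cheap h d A := by
  induction d, hcd using Nat.le_induction with
  | base => exact H
  | succ d _ ih => exact ih.succ

lemma separate {ι : Type} (B : AffineSubspace (ZMod 2) (ι → ZMod 2)) (y0 : ι → ZMod 2)
    (hy : y0 ∉ B) : ∃ (l : (ι → ZMod 2) →ₗ[ZMod 2] ZMod 2) (b : ZMod 2),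
      l y0 = b ∧ ∀ y ∈ B, l y ≠ b := by
  by_cases hB : ∃ p, p ∈ B
  · obtain ⟨p, hp⟩ := hB
    have h1 : y0 - p ∉ B.direction := by
      intro h
      apply hy
      have := AffineSubspace.vadd_mem_of_mem_direction h hp
      simpa using this
    obtain ⟨l, hl, hk⟩ := Submodule.exists_le_ker_of_notMem h1
    refine ⟨l, l y0, rfl, fun y hyB he => hl ?_⟩
    have h2 : l (y - p) = 0 := hk (AffineSubspace.vsub_mem_direction hyB hp)
    rw [map_sub] at h2 ⊢
    rw [← he, h2]
  · exact ⟨0, 0, rfl, fun y hyB => absurd ⟨y, hyB⟩ hB⟩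

lemma SDTree.cheap {ι R : Type} {h : (ι → ZMod 2) → R → Prop} (T : SDTree ι R) :
    ∀ A : Set (ι → ZMod 2), (∀ y ∈ A, h y (T.eval y)) → Cheap h T.depth A := by
  induction T with
  | leaf r => intro A H; exact ⟨r, H⟩
  | node B t0 t1 ih0 ih1 =>
    intro A H
    by_cases hAB : ∀ y ∈ A, y ∈ B
    · refine (ih1 A fun y hy => ?_).mono (by simp only [SDTree.depth]; omega)
      have := H y hy
      simpa [SDTree.eval, hAB y hy] using this
    · push Not at hAB
      obtain ⟨y0, hy0, hyB⟩ := hAB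
      obtain ⟨l, b, hl, hB⟩ := separate B y0 hyB
      refine Or.inr ⟨l, b, ⟨y0, hy0, hl⟩, fun A' _ h2 => ?_⟩
      refine (ih0 A' fun y hy => ?_).mono (by omega)
      have h3 := H y (h2 y hy).1
      have h4 : y ∉ B := fun h => hB y h (h2 y hy).2
      simpa [SDTree.eval, h4] using h3

lemma PDTree.size_pos {ι R : Type} (T : PDTree ι R) : 1 ≤ T.size := by
  induction T with
  | leaf r => simp [PDTree.size]
  | node P t0 t1 ih0 ih1 => simp only [PDTree.size]; omega

lemma PDTree.size_le {ι R : Type} (T : PDTree ι R) : T.size ≤ 2 ^ T.depth := by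
  induction T with
  | leaf r => simp [PDTree.size, PDTree.depth]
  | node P t0 t1 ih0 ih1 =>
    simp only [PDTree.size, PDTree.depth, pow_succ]
    have h0 : 2 ^ t0.depth ≤ 2 ^ max t0.depth t1.depth :=
      Nat.pow_le_pow_right (by norm_num) (le_max_left _ _)
    have h1 : 2 ^ t1.depth ≤ 2 ^ max t0.depth t1.depth :=
      Nat.pow_le_pow_right (by norm_num) (le_max_right _ _)
    omega

/-- The linear functional of a parity query. -/
def parityFun {ι : Type} [Fintype ι] (P : ι → ZMod 2) : (ι → ZMod 2) →ₗ[ZMod 2] ZMod 2 where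
  toFun x := ∑ i, P i * x i
  map_add' x y := by simp [mul_add, Finset.sum_add_distrib]
  map_smul' c x := by simp [Finset.mul_sum, mul_left_comm]

lemma zmod2_ne_one {b : ZMod 2} (h : b ≠ 1) : b = 0 := by
  revert b; decide

lemma PDTree.cheap {ι R : Type} [Fintype ι] {h : (ι → ZMod 2) → R → Prop} (T : PDTree ι R) :
    ∀ (c : ℕ) (A : Set (ι → ZMod 2)), T.size < 2 ^ (c + 1) → (∀ y ∈ A, h y (T.eval y)) →
      Cheap h c A := by
  induction T with
  | leaf r => intro c A _ H; exact Cheap.of_label ⟨r, H⟩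
  | node P t0 t1 ih0 ih1 =>
    intro c A hc H
    have p0 := t0.size_pos
    have p1 := t1.size_pos
    simp only [PDTree.size] at hc
    by_cases h1 : ∀ y ∈ A, parityFun P y = 1
    · refine ih1 c A (by omega) fun y hy => ?_
      have h2 : (∑ i, P i * y i) = 1 := h1 y hy
      simpa [PDTree.eval, h2] using H y hy
    by_cases h0 : ∀ y ∈ A, parityFun P y ≠ 1
    · refine ih0 c A (by omega) fun y hy => ?_
      have h2 : (∑ i, P i * y i) ≠ 1 := h0 y hy
      simpa [PDTree.eval, h2] using H y hy
    push Not at h0 h1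
    obtain ⟨y1, hy1, e1⟩ := h0
    obtain ⟨y0, hy0, e0⟩ := h1
    cases c with
    | zero => simp at hc; omega
    | succ c =>
      rw [pow_succ] at hc
      by_cases hs : t0.size < 2 ^ (c + 1)
      · refine Or.inr ⟨parityFun P, 0, ⟨y0, hy0, zmod2_ne_one e0⟩, fun A' _ h2 => ?_⟩
        refine ih0 c A' hs fun y hy => ?_
        have h3 : (∑ i, P i * y i) = 0 := (h2 y hy).2
        simpa [PDTree.eval, h3] using H y (h2 y hy).1
      · refine Or.inr ⟨parityFun P, 1, ⟨y1, hy1, e1⟩, fun A' _ h2 => ?_⟩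
        refine ih1 c A' (by omega) fun y hy => ?_
        have h3 : (∑ i, P i * y i) = 1 := (h2 y hy).2
        simpa [PDTree.eval, h3] using H y (h2 y hy).1

/-- The set `A` projects onto all the coordinates outside the pivots `S` and the blocks `Q`. -/
def Surj {n : ℕ} {κ : Type} (A : Set (Fin n × κ → ZMod 2)) (S : Fin n → Finset κ)
    (Q : Finset (Fin n)) : Prop :=
  ∀ t : Fin n × κ → ZMod 2, ∃ y ∈ A, ∀ i, i ∉ Q → ∀ j, j ∉ S i → y (i, j) = t (i, j)

lemma zmod2_sum {a b c : ZMod 2} (h1 : a ≠ b) (h2 : c ≠ 0) : c + a = b := by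
  revert a b c; decide

/-- Imposing one satisfiable equation costs at most one pivot. -/
lemma surj_step {n : ℕ} {κ : Type} [Fintype κ] [DecidableEq κ] (A : Set (Fin n × κ → ZMod 2))
    (S : Fin n → Finset κ) (Q : Finset (Fin n)) (hA : AffSet A) (hS : Surj A S Q)
    (l : (Fin n × κ → ZMod 2) →ₗ[ZMod 2] ZMod 2) (b : ZMod 2) (hb : ∃ y ∈ A, l y = b) :
    Surj {y | y ∈ A ∧ l y = b} S Q ∨
      ∃ i, i ∉ Q ∧ ∃ j, j ∉ S i ∧
        Surj {y | y ∈ A ∧ l y = b} (Function.update S i (insert j (S i))) Q := by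
  classical
  obtain ⟨y0, hy0, hl0⟩ := hb
  -- repairing a point using a direction
  have repair : ∀ p ∈ A, ∀ q ∈ A, l (p - q) ≠ 0 → ∀ y ∈ A, ∃ y' ∈ A, l y' = b ∧
      ∀ e, p e = q e → y' e = y e := by
    intro p hp q hq hd y hy
    by_cases e : l y = b
    · exact ⟨y, hy, e, fun _ _ => rfl⟩
    · refine ⟨p - q + y, hA p hp q hq y hy, ?_, fun e he => by simp [he]⟩
      rw [map_add]
      exact zmod2_sum e hd
  -- support of a direction on the free coordinates
  let F : Finset (Fin n × κ) := Finset.univ.filter fun e => e.1 ∉ Q ∧ e.2 ∉ S e.1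
  have key : ∀ N : ℕ, ∀ p ∈ A, ∀ q ∈ A, l (p - q) ≠ 0 →
      (F.filter fun e => p e ≠ q e).card ≤ N →
      ∃ p' ∈ A, ∃ q' ∈ A, l (p' - q') ≠ 0 ∧ ((∀ e ∈ F, p' e = q' e) ∨
        ∃ e0 ∈ F, ∀ e ∈ F, e ≠ e0 → p' e = q' e) := by
    intro N
    induction N with
    | zero =>
      intro p hp q hq hd hc
      refine ⟨p, hp, q, hq, hd, Or.inl fun e he => ?_⟩
      by_contra hne
      have : e ∈ F.filter fun e => p e ≠ q e := by simp [he, hne]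
      rw [Finset.card_eq_zero.mp (Nat.le_zero.mp hc)] at this
      simp at this
    | succ N ih =>
      intro p hp q hq hd hc
      by_cases hall : ∀ e ∈ F, p e = q e
      · exact ⟨p, hp, q, hq, hd, Or.inl hall⟩
      push Not at hall
      obtain ⟨e0, he0, hne⟩ := hall
      obtain ⟨u, hu, hu'⟩ := hS (Function.update p e0 (q e0))
      have huF : ∀ e ∈ F, u e = Function.update p e0 (q e0) e := by
        intro e he
        simp only [F, Finset.mem_filter] at he
        exact hu' e.1 he.2.1 e.2 he.2.2
      by_cases hpu : l (p - u) = 0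
      · apply ih u hu q hq
        · intro h
          apply hd
          have : p - q = (p - u) + (u - q) := by abel
          rw [this, map_add, hpu, h, add_zero]
        · have hlt : (F.filter fun e => u e ≠ q e) ⊂ (F.filter fun e => p e ≠ q e) := by
            rw [Finset.ssubset_iff_of_subset]
            · refine ⟨e0, by simp [he0, hne], ?_⟩
              simp [huF e0 he0]
            · intro e he
              simp only [Finset.mem_filter] at he ⊢
              refine ⟨he.1, ?_⟩
              by_cases h : e = e0
              · subst h; exact hne
              · have := he.2
                rw [huF e he.1, Function.update_of_ne h] at this
                exact this
          have := Finset.card_lt_card hlt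
          omega
      · refine ⟨p, hp, u, hu, hpu, Or.inr ⟨e0, he0, fun e he h => ?_⟩⟩
        rw [huF e he, Function.update_of_ne h]
  by_cases hconst : ∀ y ∈ A, l y = b
  · left
    intro t
    obtain ⟨y, hy, h⟩ := hS t
    exact ⟨y, ⟨hy, hconst y hy⟩, h⟩
  push Not at hconst
  obtain ⟨y1, hy1, hl1⟩ := hconst
  obtain ⟨p, hp, q, hq, hd, hpq⟩ := key _ y1 hy1 y0 hy0
    (by rw [map_sub, hl0]; exact sub_ne_zero.mpr hl1) le_rfl
  rcases hpq with hpq | ⟨e0, he0, hpq⟩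
  · left
    intro t
    obtain ⟨y, hy, h⟩ := hS t
    obtain ⟨y', hy', hb', hh⟩ := repair p hp q hq hd y hy
    refine ⟨y', ⟨hy', hb'⟩, fun i hi j hj => ?_⟩
    rw [hh (i, j) (hpq (i, j) (by simp [F, hi, hj]))]
    exact h i hi j hj
  · right
    simp only [F, Finset.mem_filter] at he0
    refine ⟨e0.1, he0.2.1, e0.2, he0.2.2, fun t => ?_⟩
    obtain ⟨y, hy, h⟩ := hS t
    obtain ⟨y', hy', hb', hh⟩ := repair p hp q hq hd y hy
    refine ⟨y', ⟨hy', hb'⟩, fun i hi j hj => ?_⟩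
    have hj' : j ∉ S i ∧ (i, j) ≠ e0 := by
      by_cases hie : i = e0.1
      · subst hie
        simp only [Function.update_self, Finset.mem_insert, not_or] at hj
        exact ⟨hj.2, fun hc => hj.1 (by rw [← hc])⟩
      · rw [Function.update_of_ne hie] at hj
        exact ⟨hj, fun hc => hie (by rw [← hc])⟩
    rw [hh (i, j) (hpq (i, j) (by simp [F, hi, hj'.1]) hj'.2)]
    exact h i hi j hj'.1

lemma AffSet.inter_eq {ι : Type} {A : Set (ι → ZMod 2)} (hA : AffSet A)
    (l : (ι → ZMod 2) →ₗ[ZMod 2] ZMod 2) (b : ZMod 2) : AffSet {y | y ∈ A ∧ l y = b} := by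
  intro x hx y hy z hz
  refine ⟨hA x hx.1 y hy.1 z hz.1, ?_⟩
  rw [map_add, map_sub, hx.2, hy.2, hz.2]
  abel

lemma simulate {n : ℕ} {κ R : Type} [Fintype κ] [DecidableEq κ]
    (f : (Fin n → ZMod 2) → R → Prop) (g : (κ → ZMod 2) → ZMod 2) (k : ℕ) (hg : Stifled g k)
    (c : ℕ) : ∀ (A : Set (Fin n × κ → ZMod 2)) (S : Fin n → Finset κ) (Q : Finset (Fin n))
      (a : Fin n → ZMod 2), AffSet A → Surj A S Q → (∀ i, i ∉ Q → (S i).card < k) →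
      (∀ y ∈ A, ∀ i ∈ Q, g (fun j => y (i, j)) = a i) → Cheap (Compose f g) c A →
      ∃ D : DTree (Fin n) R, D.depth * k ≤ c + ∑ i ∈ Qᶜ, (S i).card ∧
        ∀ x, (∀ i ∈ Q, x i = a i) → f x (D.eval x) := by
  have base : ∀ (c : ℕ) (A : Set (Fin n × κ → ZMod 2)) (S : Fin n → Finset κ)
      (Q : Finset (Fin n)) (a : Fin n → ZMod 2), Surj A S Q → (∀ i, i ∉ Q → (S i).card < k) →
      (∀ y ∈ A, ∀ i ∈ Q, g (fun j => y (i, j)) = a i) →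
      (∃ r, ∀ y ∈ A, Compose f g y r) →
      ∃ D : DTree (Fin n) R, D.depth * k ≤ c + ∑ i ∈ Qᶜ, (S i).card ∧
        ∀ x, (∀ i ∈ Q, x i = a i) → f x (D.eval x) := by
    intro c A S Q a hS hk ha ⟨r, hr⟩
    refine ⟨DTree.leaf r, by simp [DTree.depth], fun x hx => ?_⟩
    have hz : ∀ i, ∃ z : κ → ZMod 2, i ∉ Q →
        ∀ w : κ → ZMod 2, (∀ j, j ∉ S i → w j = z j) → g w = x i := by
      intro i
      by_cases hi : i ∈ Q
      · exact ⟨0, fun h => absurd hi h⟩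
      · obtain ⟨z, hz⟩ := hg (S i) (hk i hi).le (x i)
        exact ⟨z, fun _ => hz⟩
    choose z hz using hz
    obtain ⟨y, hy, hyz⟩ := hS fun e => z e.1 e.2
    have h1 := hr y hy
    have h2 : (fun i => g fun j => y (i, j)) = x := by
      funext i
      by_cases hi : i ∈ Q
      · rw [ha y hy i hi, hx i hi]
      · exact hz i hi _ fun j hj => hyz i hi j hj
    simp only [Compose, h2] at h1
    exact h1
  induction c with
  | zero =>
    intro A S Q a _ hS hk ha hC
    exact base 0 A S Q a hS hk ha hC
  | succ c ih =>
    intro A S Q a hA hS hk ha hC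
    rcases hC with hC | ⟨l, b, hb, hC⟩
    · exact base _ A S Q a hS hk ha hC
    have hA' : AffSet {y | y ∈ A ∧ l y = b} := hA.inter_eq l b
    rcases surj_step A S Q hA hS l b hb with h | ⟨i, hi, j, hj, h⟩
    · obtain ⟨D, hD, hD'⟩ := ih {y | y ∈ A ∧ l y = b} S Q a hA' h hk
        (fun y hy => ha y hy.1) (hC _ hb fun y hy => hy)
      exact ⟨D, by omega, hD'⟩
    set S' := Function.update S i (insert j (S i)) with hS'
    have hSi : (S' i).card = (S i).card + 1 := by
      simp [hS', Finset.card_insert_of_notMem hj]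
    have hSne : ∀ i', i' ≠ i → S' i' = S i' := fun i' h => by
      simp [hS', Function.update_of_ne h]
    have hiQ : i ∈ Qᶜ := by simpa using hi
    have hdiff : ∑ i' ∈ (insert i Q)ᶜ, (S' i').card = ∑ i' ∈ (insert i Q)ᶜ, (S i').card := by
      refine Finset.sum_congr rfl fun i' hi' => ?_
      rw [hSne i' (by rintro rfl; simp at hi')]
    have herase : (insert i Q)ᶜ = Qᶜ.erase i := by
      ext e; simp
    have hsum : ∑ i' ∈ Qᶜ, (S i').card = (S i).card + ∑ i' ∈ (insert i Q)ᶜ, (S i').card := by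
      rw [herase, Finset.add_sum_erase _ (fun i' => (S i').card) hiQ]
    have hsum' : ∑ i' ∈ Qᶜ, (S' i').card = (S' i).card + ∑ i' ∈ (insert i Q)ᶜ, (S' i').card := by
      rw [herase, Finset.add_sum_erase _ (fun i' => (S' i').card) hiQ]
    have hki := hk i hi
    by_cases hlt : (S i).card + 1 < k
    · obtain ⟨D, hD, hD'⟩ := ih {y | y ∈ A ∧ l y = b} S' Q a hA' h
        (fun i' hi' => by
          by_cases e : i' = i
          · subst e; omega
          · rw [hSne i' e]; exact hk i' hi')
        (fun y hy => ha y hy.1) (hC _ hb fun y hy => hy)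
      exact ⟨D, by omega, hD'⟩
    have hv : ∀ v : ZMod 2, ∃ D : DTree (Fin n) R,
        D.depth * k ≤ c + ∑ i' ∈ (insert i Q)ᶜ, (S' i').card ∧
          ∀ x, (∀ i' ∈ insert i Q, x i' = Function.update a i v i') → f x (D.eval x) := by
      intro v
      obtain ⟨z, hz⟩ := hg (S' i) (by omega) v
      apply ih {y | (y ∈ A ∧ l y = b) ∧ ∀ j', j' ∉ S' i → y (i, j') = z j'}
      · intro x hx y hy w hw
        refine ⟨hA' x hx.1 y hy.1 w hw.1, fun j' hj' => ?_⟩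
        simp [hx.2 j' hj', hy.2 j' hj', hw.2 j' hj']
      · intro t
        obtain ⟨y, hy, hyt⟩ := h fun e => if e.1 = i then z e.2 else t e
        refine ⟨y, ⟨hy, fun j' hj' => ?_⟩, fun i' hi' j' hj' => ?_⟩
        · simpa using hyt i hi j' hj'
        · simp only [Finset.mem_insert, not_or] at hi'
          simpa [hi'.1] using hyt i' hi'.2 j' hj'
      · intro i' hi'
        simp only [Finset.mem_insert, not_or] at hi'
        rw [hSne i' hi'.1]
        exact hk i' hi'.2
      · intro y hy i' hi'
        by_cases e : i' = i
        · subst e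
          rw [Function.update_self]
          exact hz _ hy.2
        · rw [Function.update_of_ne e]
          exact ha y hy.1.1 i' (by simpa [e] using hi')
      · apply hC
        · obtain ⟨y, hy, hyt⟩ := h fun e => z e.2
          exact ⟨y, hy, fun j' hj' => hyt i hi j' hj'⟩
        · intro y hy; exact hy.1
    obtain ⟨D0, hd0, hD0⟩ := hv 0
    obtain ⟨D1, hd1, hD1⟩ := hv 1
    refine ⟨DTree.node i D0 D1, ?_, fun x hx => ?_⟩
    · have : max D0.depth D1.depth * k ≤ c + ∑ i' ∈ (insert i Q)ᶜ, (S' i').card := by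
        rcases max_choice D0.depth D1.depth with e | e <;> rw [e] <;> assumption
      simp only [DTree.depth, add_mul, one_mul]
      omega
    · have hx' : ∀ v, x i = v → ∀ i' ∈ insert i Q, x i' = Function.update a i v i' := by
        intro v hxv i' hi'
        by_cases e : i' = i
        · subst e; simpa using hxv
        · rw [Function.update_of_ne e]
          exact hx i' (by simpa [e] using hi')
      by_cases e : x i = 1
      · simpa [DTree.eval, e] using hD1 x (hx' 1 e)
      · simpa [DTree.eval, e] using hD0 x (hx' 0 (zmod2_ne_one e))

lemma lift_of_cheap {n : ℕ} {κ R : Type} [Fintype κ] [DecidableEq κ]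
    (f : (Fin n → ZMod 2) → R → Prop) (g : (κ → ZMod 2) → ZMod 2) (k : ℕ) (hk : 1 ≤ k)
    (hg : Stifled g k) (c : ℕ) (hC : Cheap (Compose f g) c Set.univ) : DTdepth f * k ≤ c := by
  obtain ⟨D, hD, hD'⟩ := simulate f g k hg c Set.univ (fun _ => ∅) ∅ 0
    (fun _ _ _ _ _ _ => trivial) (fun t => ⟨t, trivial, fun _ _ _ _ => rfl⟩)
    (fun i _ => by simp; omega) (fun y _ i hi => by simp at hi) hC
  simp only [Finset.card_empty, Finset.sum_const_zero, add_zero] at hD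
  have h1 : DTdepth f ≤ D.depth := Nat.sInf_le ⟨D, fun x => hD' x (by simp), rfl⟩
  exact (Nat.mul_le_mul_right k h1).trans hD

lemma binIndex_injective {m : ℕ} : Function.Injective (binIndex (m := m)) := by
  intro x y h
  have h1 := finFunctionFinEquiv.injective h
  funext i
  have h2 := congrFun h1 i
  simp only [Fin.mk.injEq] at h2
  exact ZMod.val_injective 2 h2

lemma IND_stifled (m : ℕ) : Stifled (IND m) m := by
  classical
  intro S hS b
  -- address bits and data bits in `S`
  let U : Finset (Fin m) := Finset.univ.filter fun i => Sum.inl i ∉ S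
  let V : Finset (Fin (2 ^ m)) := Finset.univ.filter fun i => Sum.inr i ∈ S
  have hcard : V.card ≤ U.card := by
    have h1 : (Uᶜ).card + V.card ≤ S.card := by
      rw [← Finset.card_disjSum]
      apply Finset.card_le_card
      intro e he
      rcases e with e | e
      · simpa [U] using he
      · simpa [V] using he
    have h2 : U.card + (Uᶜ).card = m := by
      rw [Finset.card_add_card_compl]; simp
    omega
  -- partial addresses hit by `V`
  let hit : Finset (U → ZMod 2) := Finset.univ.filter fun p =>
    ∃ w : Fin m → ZMod 2, binIndex w ∈ V ∧ ∀ u : U, w u = p u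
  have hhit : hit.card ≤ V.card := by
    have hw : ∀ p : U → ZMod 2, ∃ w : Fin m → ZMod 2, p ∈ hit →
        (binIndex w ∈ V ∧ ∀ u : U, w u = p u) := by
      intro p
      by_cases hp : p ∈ hit
      · simp only [hit, Finset.mem_filter] at hp
        obtain ⟨w, hw⟩ := hp.2
        exact ⟨w, fun _ => hw⟩
      · exact ⟨0, fun h => absurd h hp⟩
    choose w hw using hw
    refine Finset.card_le_card_of_injOn (fun p => binIndex (w p)) (fun p hp => (hw p hp).1) ?_
    intro p hp q hq hpq
    have := binIndex_injective hpq
    funext u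
    rw [← (hw p hp).2 u, ← (hw q hq).2 u, this]
  have hlt : hit.card < (Finset.univ : Finset (U → ZMod 2)).card := by
    have : (Finset.univ : Finset (U → ZMod 2)).card = 2 ^ U.card := by
      simp [ZMod.card]
    rw [this]
    have := Nat.lt_two_pow_self (n := U.card)
    omega
  obtain ⟨p, -, hp⟩ := Finset.exists_mem_notMem_of_card_lt_card hlt
  refine ⟨Sum.elim (fun i => if h : i ∈ U then p ⟨i, h⟩ else 0) (fun _ => b), fun x hx => ?_⟩
  have hV : binIndex (fun i => x (Sum.inl i)) ∉ V := by
    intro hmem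
    apply hp
    simp only [hit, Finset.mem_filter, Finset.mem_univ, true_and]
    refine ⟨_, hmem, fun u => ?_⟩
    have hu : Sum.inl u.1 ∉ S := by
      exact (Finset.mem_filter.mp u.2).2
    have := hx _ hu
    simpa using this
  have hV' : Sum.inr (binIndex fun i => x (Sum.inl i)) ∉ S := by simpa [V] using hV
  have := hx _ hV'
  simpa [IND] using this

/-- For every relation `f` and positive integer `m`:
`PDT(f ∘ IND_m) ≥ DT(f)·m`, `sDT(f ∘ IND_m) ≥ DT(f)·m`, and
`PDTsize(f ∘ IND_m) ≥ 2^(DT(f)·m)`. -/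
theorem IND_lifting {n : ℕ} {R : Type} (f : (Fin n → ZMod 2) → R → Prop)
    (m : ℕ) (hm : 1 ≤ m) :
    (∀ T : PDTree (Fin n × (Fin m ⊕ Fin (2 ^ m))) R,
        T.Computes (Compose f (IND m)) → DTdepth f * m ≤ T.depth) ∧
    (∀ T : SDTree (Fin n × (Fin m ⊕ Fin (2 ^ m))) R,
        T.Computes (Compose f (IND m)) → DTdepth f * m ≤ T.depth) ∧
    (∀ T : PDTree (Fin n × (Fin m ⊕ Fin (2 ^ m))) R,
        T.Computes (Compose f (IND m)) → 2 ^ (DTdepth f * m) ≤ T.size) := by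
  have hst := IND_stifled m
  have hsize : ∀ T : PDTree (Fin n × (Fin m ⊕ Fin (2 ^ m))) R,
      T.Computes (Compose f (IND m)) → 2 ^ (DTdepth f * m) ≤ T.size := by
    intro T hT
    by_contra hlt
    push Not at hlt
    have hpos := T.size_pos
    obtain ⟨c, hc⟩ : ∃ c, DTdepth f * m = c + 1 := by
      refine Nat.exists_eq_succ_of_ne_zero fun h0 => ?_
      rw [h0] at hlt
      simp at hlt
      omega
    rw [hc] at hlt
    have := lift_of_cheap f (IND m) m hm hst c (T.cheap c _ hlt fun y _ => hT y)
    omega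
  refine ⟨fun T hT => ?_, fun T hT => ?_, hsize⟩
  · exact (Nat.pow_le_pow_iff_right (by norm_num)).mp ((hsize T hT).trans T.size_le)
  · exact lift_of_cheap f (IND m) m hm hst _ (T.cheap _ fun y _ => hT y)
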